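/- Let m, b, c be positive integers with m > 2, and let p > 2 and q be two distinct primes such that p divides q^{2b} + 1 and q^{2c+1} exactly divides m−1. If p does not divide (m−2)·k, then there does not exist a (q^{2b}+1, m, k, λ)-SEDF in any finite abelian group. -/

import Mathlib

/-- A `(v,m,k,λ)`-strong external difference family in a finite abelian group `G`. -/
def IsSEDF {G : Type*} [CommGroup G] [Fintype G] [DecidableEq G]
    {m : ℕ} (D : Fin m → Finset G) (k lam : ℕ) : Prop :=
  0 < m ∧ 0 < k ∧ 0 < lam ∧
  (∀ i, (D i).card = k) ∧
  (∀ i j, i ≠ j → Disjoint (D i) (D j)) ∧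
  ∀ j : Fin m, ∀ g : G,
    (∑ l ∈ Finset.univ.filter (fun l => l ≠ j),
      (((D l) ×ˢ (D j)).filter (fun x => x.1 * x.2⁻¹ = g)).card)
    = if g = 1 then 0 else lam

open Polynomial ComplexConjugate in
/-- Frobenius for integer polynomials: `f ^ (ℓ ^ n) ≡ f (X ^ (ℓ ^ n))` modulo a prime `ℓ`. -/
lemma exists_pow_prime_pow_eq_expand_add (ℓ : ℕ) (hℓ : ℓ.Prime) (n : ℕ) (f : ℤ[X]) :
    ∃ g : ℤ[X], f ^ (ℓ ^ n) = expand ℤ (ℓ ^ n) f + C (ℓ : ℤ) * g := by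
  have : Fact ℓ.Prime := ⟨hℓ⟩
  have h : C (ℓ : ℤ) ∣ f ^ (ℓ ^ n) - expand ℤ (ℓ ^ n) f := by
    rw [C_dvd_iff_dvd_coeff]
    intro i
    rw [← ZMod.intCast_zmod_eq_zero_iff_dvd]
    have h0 : (f ^ (ℓ ^ n) - expand ℤ (ℓ ^ n) f).map (Int.castRingHom (ZMod ℓ)) = 0 := by
      rw [Polynomial.map_sub, Polynomial.map_pow, map_expand, sub_eq_zero]
      induction n with
      | zero => simp
      | succ n ih => rw [pow_succ, pow_mul, ih, ← ZMod.expand_card, expand_expand, mul_comm]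
    simpa only [coeff_map, eq_intCast, coeff_zero] using congrArg (fun r => r.coeff i) h0
  obtain ⟨g, hg⟩ := h
  exact ⟨g, by rw [← hg]; ring⟩

/-- If an integer `n` is `ℓ` times an algebraic integer, then `ℓ ∣ n`. -/
lemma int_dvd_of_isIntegral {z : ℂ} (hz : IsIntegral ℤ z) {ℓ n : ℤ} (hℓ : ℓ ≠ 0)
    (h : (ℓ : ℂ) * z = n) : ℓ ∣ n := by
  have hℓ' : (ℓ : ℂ) ≠ 0 := by exact_mod_cast hℓ
  have hz' : z = algebraMap ℚ ℂ (n / ℓ) := by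
    simp only [eq_ratCast, Rat.cast_div, Rat.cast_intCast]
    rw [eq_div_iff hℓ', mul_comm, h]
  rw [hz', isIntegral_algebraMap_iff (algebraMap ℚ ℂ).injective] at hz
  obtain ⟨y, hy⟩ := IsIntegrallyClosed.isIntegral_iff.mp hz
  refine ⟨y, ?_⟩
  have hq : (ℓ : ℚ) ≠ 0 := by exact_mod_cast hℓ
  have : (n : ℚ) = ℓ * y := by
    rw [eq_intCast] at hy
    rw [hy]
    field_simp
  exact_mod_cast this

lemma isIntegral_aeval {ζ : ℂ} (hζ : IsIntegral ℤ ζ) (f : Polynomial ℤ) :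
    IsIntegral ℤ (Polynomial.aeval ζ f) :=
  IsIntegral.of_mem_of_fg _ hζ.fg_adjoin_singleton _ (Polynomial.aeval_mem_adjoin_singleton _ _)

open Polynomial ComplexConjugate in
lemma conj_aeval (ζ : ℂ) (f : ℤ[X]) : conj (aeval ζ f) = aeval (conj ζ) f := by
  simpa using (map_aeval_eq_aeval_map (φ := RingHom.id ℤ) (ψ := starRingEnd ℂ)
    (RingHom.ext_int _ _) f ζ)

open Polynomial ComplexConjugate in
/-- If `q` is self-conjugate for `ζ`, then `q ∣ X * conj X` in `ℤ[ζ]` forces `q ∣ X`. -/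
lemma exists_eq_prime_mul_of_mul_conj {ζ : ℂ} {q a : ℕ} (hq : q.Prime) (ha : 0 < a)
    (hζ : conj ζ = ζ ^ q ^ a) (f : ℤ[X]) {N : ℕ}
    (h : aeval ζ f * conj (aeval ζ f) = (q : ℂ) * N) :
    ∃ g : ℤ[X], aeval ζ f = (q : ℂ) * aeval ζ g := by
  obtain ⟨g₁, h₁⟩ := exists_pow_prime_pow_eq_expand_add q hq a f
  obtain ⟨g₂, h₂⟩ := exists_pow_prime_pow_eq_expand_add q hq (a + a) f
  have hζ2 : ζ ^ q ^ (a + a) = ζ := by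
    rw [pow_add, pow_mul, ← hζ, ← map_pow, ← hζ, Complex.conj_conj]
  have e₁ := congrArg (aeval ζ) h₁
  have e₂ := congrArg (aeval ζ) h₂
  simp only [map_pow, map_add, map_mul, expand_aeval, aeval_C, ← hζ, hζ2, ← conj_aeval] at e₁ e₂
  simp only [algebraMap_int_eq, eq_intCast, Int.cast_natCast] at e₁ e₂
  have hQ : 2 ≤ q ^ a := hq.two_le.trans (Nat.le_self_pow ha.ne' q)
  have hle : q ^ a + 1 ≤ q ^ (a + a) := by rw [pow_add]; nlinarith
  obtain ⟨r, hr⟩ := Nat.exists_eq_add_of_le hle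
  refine ⟨(C (N : ℤ) + g₁ * f) * f ^ r - g₂, ?_⟩
  rw [hr, pow_add, pow_succ, e₁] at e₂
  simp only [map_sub, map_mul, map_add, map_pow, map_natCast]
  linear_combination (aeval ζ f) ^ r * h - e₂

open Polynomial ComplexConjugate in
/-- If `q` is self-conjugate for `ζ`, then the `q`-adic valuation of an integer of the form
`X * conj X` with `X ∈ ℤ[ζ]` is even. -/
lemma even_padicValNat_of_mul_conj {ζ : ℂ} {q a : ℕ} (hq : q.Prime) (ha : 0 < a)
    (hint : IsIntegral ℤ ζ) (hζ : conj ζ = ζ ^ q ^ a) (N : ℕ) (hN : N ≠ 0) (f : ℤ[X])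
    (h : aeval ζ f * conj (aeval ζ f) = (N : ℂ)) : Even (padicValNat q N) := by
  have : Fact q.Prime := ⟨hq⟩
  induction N using Nat.strong_induction_on generalizing f with
  | _ N ih =>
    by_cases hd : q ∣ N
    · obtain ⟨N₁, rfl⟩ := hd
      obtain ⟨g, hg⟩ := exists_eq_prime_mul_of_mul_conj hq ha hζ f (N := N₁) (by rw [h]; simp)
      have hq0 : (q : ℂ) ≠ 0 := by exact_mod_cast hq.ne_zero
      have hg' : (q : ℂ) * (aeval ζ g * conj (aeval ζ g)) = N₁ := by
        apply mul_left_cancel₀ hq0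
        rw [hg] at h
        simp only [map_mul, Complex.conj_natCast, Nat.cast_mul] at h
        linear_combination h
      have hgint : IsIntegral ℤ (aeval ζ g * conj (aeval ζ g)) := by
        rw [conj_aeval, hζ]
        exact (isIntegral_aeval hint g).mul (isIntegral_aeval (hint.pow _) g)
      have hd : (q : ℤ) ∣ (N₁ : ℤ) := int_dvd_of_isIntegral hgint
        (by exact_mod_cast hq.ne_zero) (by exact_mod_cast hg')
      obtain ⟨N₂, rfl⟩ := Int.natCast_dvd_natCast.mp hd
      have hN2 : N₂ ≠ 0 := by rintro rfl; simp at hN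
      have hlt : N₂ < q * (q * N₂) := by
        have := hq.two_le
        have := Nat.pos_of_ne_zero hN2
        nlinarith [Nat.mul_le_mul_right N₂ hq.two_le]
      have key := ih N₂ hlt hN2 g (by
        apply mul_left_cancel₀ hq0
        rw [hg']; push_cast; ring)
      rw [padicValNat.mul hq.ne_zero (mul_ne_zero hq.ne_zero hN2),
        padicValNat.mul hq.ne_zero hN2, padicValNat_self, ← add_assoc]
      exact (by decide : Even (1 + 1)).add key
    · rw [padicValNat.eq_zero_of_not_dvd hd]
      exact Even.zero

/-- A finite abelian group of order divisible by `p` has a complex character of order `p`. -/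
lemma exists_monoidHom_pow_eq_one {G : Type*} [CommGroup G] [Fintype G] {p : ℕ} (hp : p.Prime)
    (h : p ∣ Fintype.card G) : ∃ χ : G →* ℂ, χ ≠ 1 ∧ ∀ g, χ g ^ p = 1 := by
  have : Fact p.Prime := ⟨hp⟩
  have : NeZero (Monoid.exponent G) := ⟨Monoid.exponent_ne_zero_of_finite⟩
  obtain ⟨e⟩ := CommGroup.monoidHom_mulEquiv_of_hasEnoughRootsOfUnity G ℂ
  have : Finite (G →* ℂˣ) := Finite.of_equiv G e.symm.toEquiv
  obtain ⟨χ, hχ⟩ := exists_prime_orderOf_dvd_card' (G := G →* ℂˣ) p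
    (by rwa [Nat.card_congr e.toEquiv, Nat.card_eq_fintype_card])
  refine ⟨(Units.coeHom ℂ).comp χ, fun h1 => ?_, fun g => ?_⟩
  · have : χ = 1 := by
      ext g
      simpa using DFunLike.congr_fun h1 g
    rw [this, orderOf_one] at hχ
    exact hp.one_lt.ne hχ
  · have := DFunLike.congr_fun (pow_orderOf_eq_one χ) g
    rw [hχ] at this
    simpa using congrArg Units.val this

/-- The defining identity of an SEDF, seen through a multiplicative character. -/
lemma IsSEDF.sum_mul_sum {G : Type*} [CommGroup G] [Fintype G] [DecidableEq G]
    {m : ℕ} {D : Fin m → Finset G} {k lam : ℕ} (h : IsSEDF D k lam) (f : G →* ℂ) (j : Fin m) :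
    ((∑ l, ∑ x ∈ D l, f x) - ∑ x ∈ D j, f x) * ∑ y ∈ D j, f y⁻¹ = lam * (∑ g, f g - 1) := by
  obtain ⟨-, -, -, -, -, h⟩ := h
  have e : ∀ l, (∑ x ∈ D l, f x) * ∑ y ∈ D j, f y⁻¹ =
      ∑ g, f g * (((D l) ×ˢ (D j)).filter (fun x => x.1 * x.2⁻¹ = g)).card := by
    intro l
    rw [Finset.sum_mul_sum, ← Finset.sum_product',
      ← Finset.sum_fiberwise _ (fun x : G × G => x.1 * x.2⁻¹)]
    refine Finset.sum_congr rfl fun g _ => ?_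
    rw [Finset.sum_congr rfl (g := fun _ => f g), Finset.sum_const, nsmul_eq_mul, mul_comm]
    intro x hx
    rw [← (Finset.mem_filter.mp hx).2, map_mul]
  have hsub : (∑ l, ∑ x ∈ D l, f x) - ∑ x ∈ D j, f x =
      ∑ l ∈ Finset.univ.filter (fun l => l ≠ j), ∑ x ∈ D l, f x := by
    rw [Finset.filter_ne', ← Finset.add_sum_erase _ _ (Finset.mem_univ j)]
    ring
  rw [hsub, Finset.sum_mul, Finset.sum_congr rfl (fun l _ => e l), Finset.sum_comm]
  simp_rw [← Finset.mul_sum, ← Nat.cast_sum, h j]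
  rw [← Finset.add_sum_erase _ _ (Finset.mem_univ (1 : G)),
    ← Finset.add_sum_erase _ (fun g => f g) (Finset.mem_univ (1 : G))]
  simp only [if_true, Nat.cast_zero, mul_zero, zero_add, map_one, add_sub_cancel_left]
  rw [Finset.mul_sum]
  refine Finset.sum_congr rfl fun g hg => ?_
  rw [if_neg (Finset.ne_of_mem_erase hg), mul_comm]

/-- The counting identity `k² (m - 1) = λ (v - 1)` for an SEDF. -/
lemma IsSEDF.sq_mul_pred {G : Type*} [CommGroup G] [Fintype G] [DecidableEq G]
    {m : ℕ} {D : Fin m → Finset G} {k lam : ℕ} (h : IsSEDF D k lam) :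
    k ^ 2 * (m - 1) = lam * (Fintype.card G - 1) := by
  have hm := h.1
  have e := h.sum_mul_sum 1 ⟨0, hm⟩
  simp only [MonoidHom.one_apply, Finset.sum_const, h.2.2.2.1, nsmul_eq_mul, mul_one,
    Finset.card_univ, Fintype.card_fin] at e
  have hv : 1 ≤ Fintype.card G := Fintype.card_pos
  zify [hm, hv, Nat.succ_le_of_lt hm]
  have : ((k : ℂ) ^ 2 * (m - 1)) = lam * (Fintype.card G - 1) := by
    linear_combination e
  exact_mod_cast this

open Polynomial in
/-- A sum of `p`-th roots of unity is congruent to its number of terms after raising to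
the power `p`. -/
lemma exists_pow_sub_eval_one {ζ : ℂ} {p : ℕ} (hp : p.Prime) (hζ : ζ ^ p = 1) (f : ℤ[X]) :
    ∃ g : ℤ[X], (aeval ζ f) ^ p = (f.eval 1 : ℤ) + p * aeval ζ g := by
  obtain ⟨g, hg⟩ := exists_pow_prime_pow_eq_expand_add p hp 1 f
  refine ⟨g, ?_⟩
  have e := congrArg (aeval ζ) hg
  simp only [pow_one, map_pow, map_add, map_mul, expand_aeval, aeval_C, hζ] at e
  rw [e]
  have : aeval (1 : ℂ) f = ((f.eval 1 : ℤ) : ℂ) := by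
    have := aeval_algebraMap_apply ℂ (1 : ℤ) f
    simpa using this
  simp [this]

open Polynomial in
/-- If two integer polynomials agree at a `p`-th root of unity, their values at `1` agree
modulo `p`. -/
lemma dvd_eval_one_sub {ζ : ℂ} {p : ℕ} (hp : p.Prime) (hζ : ζ ^ p = 1) {f₁ f₂ : ℤ[X]}
    (h : aeval ζ f₁ = aeval ζ f₂) : (p : ℤ) ∣ f₁.eval 1 - f₂.eval 1 := by
  obtain ⟨g₁, h₁⟩ := exists_pow_sub_eval_one hp hζ f₁
  obtain ⟨g₂, h₂⟩ := exists_pow_sub_eval_one hp hζ f₂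
  have hint : IsIntegral ℤ ζ := .of_pow hp.pos (by rw [hζ]; exact isIntegral_one)
  refine int_dvd_of_isIntegral (isIntegral_aeval hint (g₂ - g₁))
    (by exact_mod_cast hp.ne_zero) ?_
  rw [h, h₂] at h₁
  push_cast
  rw [map_sub]
  linear_combination h₁

open ComplexConjugate in
/-- If `(S - x) * conj x` takes the same real value at `x` and `y`, where `S ≠ 0`,
then `x = y` or `x + y = S`. -/
lemma eq_or_add_eq_of_sub_mul_conj {S x y : ℂ} {r : ℝ} (hS : S ≠ 0)
    (hx : (S - x) * conj x = r) (hy : (S - y) * conj y = r) : x = y ∨ x + y = S := by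
  have hx' := congrArg conj hx
  have hy' := congrArg conj hy
  simp only [map_mul, map_sub, Complex.conj_conj, Complex.conj_ofReal] at hx' hy'
  have hS' : conj S ≠ 0 := (map_ne_zero _).mpr hS
  have cx : S * conj x = conj S * x := by linear_combination hx - hx'
  have cy : S * conj y = conj S * y := by linear_combination hy - hy'
  have key : conj S * ((x - y) * (x + y - S)) = 0 := by
    linear_combination (-S) * hx + S * hy + (S - x) * cx - (S - y) * cy
  rcases mul_eq_zero.mp ((mul_eq_zero.mp key).resolve_left hS') with h | h
  · exact .inl (sub_eq_zero.mp h)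
  · exact .inr (sub_eq_zero.mp h)

open Polynomial ComplexConjugate in
/-- Let `m, b, c` be positive integers with `m > 2`, and `p > 2`, `q` distinct primes
with `p ∣ q^{2b}+1` and `q^{2c+1} ∥ m-1`.  If `p ∤ (m-2)k`, then no
`(q^{2b}+1, m, k, λ)`-SEDF exists in any finite abelian group. -/
theorem sedf_nonexistence_even_power
    (m b c : ℕ) (hm : 2 < m) (hb : 0 < b) (hc : 0 < c)
    (p q : ℕ) (hp : p.Prime) (hp2 : 2 < p) (hq : q.Prime) (hpq : p ≠ q)
    (hdvd : p ∣ q ^ (2 * b) + 1)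
    (hexact : q ^ (2 * c + 1) ∣ m - 1 ∧ ¬ q ^ (2 * c + 2) ∣ m - 1)
    (k lam : ℕ) (hk : ¬ p ∣ (m - 2) * k) :
    ∀ (G : Type) [CommGroup G] [Fintype G] [DecidableEq G] (D : Fin m → Finset G),
      Fintype.card G = q ^ (2 * b) + 1 → ¬ IsSEDF D k lam := by
  intro G _ _ _ D hG hD
  have : Fact q.Prime := ⟨hq⟩
  obtain ⟨χ, hχ1, hχp⟩ := exists_monoidHom_pow_eq_one hp (hG ▸ hdvd)
  set ζ := Complex.exp (2 * Real.pi * Complex.I / p)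
  have hprim : IsPrimitiveRoot ζ p := Complex.isPrimitiveRoot_exp p hp.ne_zero
  have : NeZero p := ⟨hp.ne_zero⟩
  have hint : IsIntegral ℤ ζ := .of_pow hp.pos (by rw [hprim.pow_eq_one]; exact isIntegral_one)
  have hconj : ∀ z : ℂ, z ^ p = 1 → conj z = z⁻¹ := fun z hz =>
    (Complex.inv_eq_conj (Complex.norm_eq_one_of_pow_eq_one hz hp.ne_zero)).symm
  have hζq : conj ζ = ζ ^ q ^ (2 * b) := by
    rw [hconj ζ hprim.pow_eq_one]
    refine inv_eq_of_mul_eq_one_right ?_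
    rw [← pow_succ']
    exact (hprim.pow_eq_one_iff_dvd _).mpr hdvd
  have hex : ∀ g, ∃ i, ζ ^ i = χ g := fun g => by
    obtain ⟨i, -, hi⟩ := hprim.eq_pow_of_pow_eq_one (hχp g)
    exact ⟨i, hi⟩
  choose n hn using hex
  set F : Fin m → ℤ[X] := fun j => ∑ g ∈ D j, X ^ n g with hF
  have hFχ : ∀ j, aeval ζ (F j) = ∑ g ∈ D j, χ g := fun j => by simp [hF, hn]
  have hF1 : ∀ j, (F j).eval 1 = k := fun j => by
    simp [hF, eval_finsetSum, hD.2.2.2.1 j]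
  have hFconj : ∀ j, conj (aeval ζ (F j)) = ∑ g ∈ D j, χ g⁻¹ := fun j => by
    rw [hFχ, map_sum]
    refine Finset.sum_congr rfl fun g _ => ?_
    rw [hconj _ (hχp g)]
    refine inv_eq_of_mul_eq_one_right ?_
    rw [← map_mul, mul_inv_cancel, map_one]
  have hlam := hD.2.2.1
  have key : ∀ j, (∑ l, aeval ζ (F l) - aeval ζ (F j)) * conj (aeval ζ (F j)) =
      ((-lam : ℝ) : ℂ) := fun j => by
    have := hD.sum_mul_sum χ j
    rw [sum_hom_units_eq_zero χ hχ1] at this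
    rw [hFconj]
    simp only [hFχ]
    rw [this]
    push_cast
    ring
  have h0 : 0 < m := by omega
  by_cases hS : ∑ l, aeval ζ (F l) = 0
  · have heven := even_padicValNat_of_mul_conj hq (by omega : 0 < 2 * b) hint hζq lam hlam.ne'
      (F ⟨0, h0⟩) (by
        have := key ⟨0, h0⟩
        rw [hS] at this
        push_cast at this
        linear_combination -this)
    have hcount := congrArg (padicValNat q) hD.sq_mul_pred
    have hm1 : m - 1 ≠ 0 := by omega
    have hval : padicValNat q (m - 1) = 2 * c + 1 := by
      apply le_antisymm
      · by_contra! hlt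
        exact hexact.2 ((padicValNat_dvd_iff_le hm1).mpr hlt)
      · exact (padicValNat_dvd_iff_le hm1).mp hexact.1
    rw [hG, Nat.add_sub_cancel, padicValNat.mul (pow_ne_zero _ hD.2.1.ne') hm1,
      padicValNat.mul hlam.ne' (pow_ne_zero _ hq.ne_zero), padicValNat.pow, padicValNat.prime_pow,
      hval] at hcount
    obtain ⟨r, hr⟩ := heven
    omega
  · by_cases hall : ∀ j, aeval ζ (F j) = aeval ζ (F ⟨0, h0⟩)
    · have e := key ⟨0, h0⟩
      rw [Finset.sum_congr rfl (fun l _ => hall l), Finset.sum_const, Finset.card_univ,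
        Fintype.card_fin, nsmul_eq_mul] at e
      have e' : ((m : ℝ) - 1) * Complex.normSq (aeval ζ (F ⟨0, h0⟩)) = -lam := by
        have hn := Complex.mul_conj (aeval ζ (F ⟨0, h0⟩))
        apply Complex.ofReal_injective
        rw [← e]
        push_cast
        rw [← hn]
        ring
      have h1 : (0 : ℝ) < lam := by exact_mod_cast hlam
      have h2 : (2 : ℝ) < m := by exact_mod_cast hm
      nlinarith [mul_nonneg (by linarith : (0 : ℝ) ≤ m - 1)
        (Complex.normSq_nonneg (aeval ζ (F ⟨0, h0⟩)))]
    · push Not at hall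
      obtain ⟨j, hj⟩ := hall
      have hadd := (eq_or_add_eq_of_sub_mul_conj hS (key j) (key ⟨0, h0⟩)).resolve_left hj
      rw [← map_add, ← map_sum] at hadd
      have hd := dvd_eval_one_sub hp hprim.pow_eq_one hadd.symm
      simp only [eval_finsetSum, eval_add, hF1, Finset.sum_const, Finset.card_univ,
        Fintype.card_fin, nsmul_eq_mul] at hd
      apply hk
      zify [hm.le]
      convert hd using 1
      ring
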